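/- Let G be a finite group such that for some prime p, G contains a subgroup isomorphic to (ℤ/p) × (ℤ/p) × (ℤ/p). Then there is no central extension 1 → H → Q → G → 1 with H cyclic and Q containing no subgroup isomorphic to (ℤ/q) × (ℤ/q) for any prime q. -/

import Mathlib

universe u

open scoped commutatorElement

/-- In a finite cyclic group, the elements killed by a prime `p` are powers of any
element of order `p`. -/
theorem IsCyclic.mem_zpowers_of_pow_prime_eq_one {H : Type*} [Group H] [IsCyclic H] [Finite H]
    {p : ℕ} (hp : p.Prime) {u v : H} (hu : u ^ p = 1) (hu1 : u ≠ 1) (hv : v ^ p = 1) :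
    v ∈ Subgroup.zpowers u := by
  let : CommGroup H := IsCyclic.commGroup
  have := Fact.mk hp
  have hle : Subgroup.zpowers u ≤ (powMonoidHom p : H →* H).ker := by
    rw [Subgroup.zpowers_le, MonoidHom.mem_ker]
    exact hu
  have hcard : Nat.card (powMonoidHom p : H →* H).ker ≤ Nat.card (Subgroup.zpowers u) := by
    rw [IsCyclic.card_powMonoidHom_ker, Nat.card_zpowers, orderOf_eq_prime hu hu1]
    exact Nat.gcd_le_right _ hp.pos
  rw [Subgroup.eq_of_le_of_card_ge hle hcard, MonoidHom.mem_ker]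
  exact hv

/-- Two independent commuting elements of order `p` generate a copy of `(ℤ/p) × (ℤ/p)`. -/
theorem Commute.exists_subgroup_mulEquiv_zmod_prod {Q : Type*} [Group Q] {p : ℕ} (hp : p.Prime)
    {x y : Q} (hxy : Commute x y) (hx : x ^ p = 1) (hy : y ^ p = 1) (hx1 : x ≠ 1)
    (hyx : y ∉ Subgroup.zpowers x) :
    ∃ K : Subgroup Q, Nonempty (K ≃* Multiplicative (ZMod p × ZMod p)) := by
  have := Fact.mk hp
  have hy1 : y ≠ 1 := fun h => hyx (h ▸ one_mem _)
  have hcx : Nat.card (Subgroup.zpowers x) = p := by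
    rw [Nat.card_zpowers, orderOf_eq_prime hx hx1]
  have hcy : Nat.card (Subgroup.zpowers y) = p := by
    rw [Nat.card_zpowers, orderOf_eq_prime hy hy1]
  have hcz : Nat.card (Multiplicative (ZMod p)) = p := Nat.card_zmod p
  have comm : ∀ (m : Subgroup.zpowers x) (n : Subgroup.zpowers y),
      Commute ((Subgroup.zpowers x).subtype m) ((Subgroup.zpowers y).subtype n) := by
    rintro ⟨_, i, rfl⟩ ⟨_, j, rfl⟩
    exact hxy.zpow_zpow i j
  have hdisj : Disjoint (Subgroup.zpowers x) (Subgroup.zpowers y) := by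
    have : Fact (Nat.card (Subgroup.zpowers y)).Prime := ⟨hcy ▸ hp⟩
    rcases Subgroup.eq_bot_or_eq_top_of_prime_card
      ((Subgroup.zpowers x).subgroupOf (Subgroup.zpowers y)) with h | h
    · exact Subgroup.subgroupOf_eq_bot.mp h
    · exact absurd (Subgroup.subgroupOf_eq_top.mp h (Subgroup.mem_zpowers y)) hyx
  have hinj : Function.Injective (MonoidHom.noncommCoprod _ _ comm) := by
    rw [MonoidHom.noncommCoprod_injective, Subgroup.range_subtype, Subgroup.range_subtype]
    exact ⟨Subtype.val_injective, Subtype.val_injective, hdisj⟩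
  exact ⟨_, ⟨(MonoidHom.ofInjective hinj).symm.trans
    (((mulEquivOfPrimeCardEq hcx hcz).prodCongr (mulEquivOfPrimeCardEq hcy hcz)).trans
      (MulEquiv.prodMultiplicative _ _).symm)⟩⟩

/-- If commuting elements `x`, `y` have images under `φ` that are independent in an elementary
abelian `p`-subgroup, then the source contains a copy of `(ℤ/p) × (ℤ/p)`. -/
theorem Commute.exists_subgroup_mulEquiv_zmod_prod_of_map {Q G : Type*} [Group Q] [Finite Q]
    [Group G] {p : ℕ} (hp : p.Prime) (φ : Q →* G) {K : Subgroup G}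
    (hK : ∀ g ∈ K, g ^ p = 1) {x y : Q} (hxy : Commute x y) (hx : φ x ∈ K) (hy : φ y ∈ K)
    (hx1 : φ x ≠ 1) (hyx : φ y ∉ Subgroup.zpowers (φ x)) :
    ∃ L : Subgroup Q, Nonempty (L ≃* Multiplicative (ZMod p × ZMod p)) := by
  have := Fact.mk hp
  let A : Subgroup Q := Subgroup.closure {x, y}
  have hA : ∀ a ∈ ({x, y} : Set Q), ∀ b ∈ ({x, y} : Set Q), a * b = b * a := by
    rintro a (rfl | rfl) b (rfl | rfl)
    exacts [rfl, hxy, hxy.symm, rfl]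
  let : CommGroup A :=
    { mul_comm := (Subgroup.isMulCommutative_closure hA).is_comm.comm }
  have hxA : x ∈ A := Subgroup.subset_closure (by simp)
  have hyA : y ∈ A := Subgroup.subset_closure (by simp)
  have hAK : A ≤ K.comap φ := by
    rw [Subgroup.closure_le]
    rintro a (rfl | rfl)
    exacts [hx, hy]
  let ψ : A →* G := φ.comp A.subtype
  let P : A →* A := powMonoidHom p
  have hlt : p < Nat.card ψ.range := by
    have hle : Subgroup.zpowers (φ x) ≤ ψ.range := by
      rw [Subgroup.zpowers_le]
      exact ⟨⟨x, hxA⟩, rfl⟩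
    have : Finite ψ.range := Set.finite_range ψ
    by_contra! h
    have heq := Subgroup.eq_of_le_of_card_ge hle
      (by rwa [Nat.card_zpowers, orderOf_eq_prime (hK _ hx) hx1])
    exact hyx (heq ▸ ⟨⟨y, hyA⟩, rfl⟩)
  have hPψ : P.range ≤ ψ.ker := by
    rintro _ ⟨a, rfl⟩
    rw [MonoidHom.mem_ker, powMonoidHom_apply, map_pow]
    exact hK _ (hAK a.2)
  have hker : p < Nat.card P.ker := by
    rw [← Subgroup.index_range]
    rw [← Subgroup.index_ker] at hlt
    exact hlt.trans_le (Subgroup.index_antitone hPψ)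
  obtain ⟨s, hs, hs1⟩ := P.ker.bot_or_exists_ne_one.resolve_left
    ((Subgroup.one_lt_card_iff_ne_bot _).mp (hp.one_lt.trans hker))
  have hsp : s ^ p = 1 := hs
  obtain ⟨t, ht, hts⟩ : ∃ t ∈ P.ker, t ∉ Subgroup.zpowers s := by
    by_contra! h
    have := Subgroup.card_le_of_le h
    rw [Nat.card_zpowers, orderOf_eq_prime hsp hs1] at this
    omega
  have htp : t ^ p = 1 := ht
  refine Commute.exists_subgroup_mulEquiv_zmod_prod hp (x := (s : Q)) (y := (t : Q)) ?_ ?_ ?_ ?_ ?_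
  · exact congrArg Subtype.val (mul_comm s t)
  · exact congrArg Subtype.val hsp
  · exact congrArg Subtype.val htp
  · exact fun h => hs1 (Subtype.ext h)
  · rintro ⟨k, hk⟩
    exact hts ⟨k, Subtype.ext hk⟩

/-- In an extension of an elementary abelian `p`-group by a central cyclic group, for any `a`,
`b`, `c` either `a` commutes with `b`, or it commutes with `c * b ^ k` for some `k`. -/
theorem commute_or_exists_commute_mul_zpow {Q : Type*} [Group Q] [Finite Q] {p : ℕ}
    (hp : p.Prime) {H : Subgroup Q} (hH : H ≤ Subgroup.center Q) [IsCyclic H] {a b c : Q}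
    (hb : b ^ p ∈ H) (hc : c ^ p ∈ H) (hab : ⁅a, b⁆ ∈ H) (hac : ⁅a, c⁆ ∈ H) :
    Commute a b ∨ ∃ k : ℤ, Commute a (c * b ^ k) := by
  have key : ∀ d : Q, d ^ p ∈ H → ⁅a, d⁆ ∈ H → ⁅a, d⁆ ^ p = 1 := by
    intro d hd had
    have h1 : (a * d * a⁻¹) ^ p = d ^ p := by
      rw [conj_pow, (Subgroup.mem_center_iff.mp (hH hd) a), mul_inv_cancel_right]
    have h2 : a * d * a⁻¹ = ⁅a, d⁆ * d := by simp [commutatorElement_def]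
    have h3 : Commute ⁅a, d⁆ d := (Subgroup.mem_center_iff.mp (hH had) d).symm
    rwa [h2, h3.mul_pow, mul_eq_right] at h1
  by_cases hu : ⁅a, b⁆ = 1
  · exact Or.inl (commutatorElement_eq_one_iff_commute.mp hu)
  right
  obtain ⟨k, hk⟩ := IsCyclic.mem_zpowers_of_pow_prime_eq_one hp
    (u := (⟨⁅a, b⁆, hab⟩ : H)) (v := ⟨⁅a, c⁆, hac⟩) (Subtype.ext (key b hb hab))
    (fun h => hu (congrArg Subtype.val h)) (Subtype.ext (key c hc hac))
  have hk : ⁅a, b⁆ ^ k = ⁅a, c⁆ := congrArg Subtype.val hk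
  refine ⟨-k, ?_⟩
  have hcen : ∀ g : Q, Commute g ⁅a, b⁆ := fun g => Subgroup.mem_center_iff.mp (hH hab) g
  have h1 : SemiconjBy a b (⁅a, b⁆ * b) := by
    simp [SemiconjBy, commutatorElement_def]
  have h2 : SemiconjBy a c (⁅a, b⁆ ^ k * c) := by
    rw [hk]
    simp [SemiconjBy, commutatorElement_def]
  have h3 := h2.mul_right (h1.zpow_right (-k))
  have h4 : ⁅a, b⁆ ^ k * c * (⁅a, b⁆ * b) ^ (-k) = c * b ^ (-k) := by
    rw [((hcen b).symm).mul_zpow, ← ((hcen c).zpow_right k).eq, mul_assoc,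
      ← mul_assoc (⁅a, b⁆ ^ k), ← zpow_add, add_neg_cancel, zpow_zero, one_mul]
  rwa [h4] at h3

/-- If a finite group `G` contains a subgroup isomorphic to
`(ℤ/p) × (ℤ/p) × (ℤ/p)` for some prime `p`, then `G` is not the quotient of a finite group
`Q` with periodic cohomology (i.e. with no subgroup `(ℤ/q) × (ℤ/q)` for any prime `q`) by a
central cyclic subgroup. -/
theorem stmt_14 (G : Type u) [Group G] [Finite G] (p : ℕ) (hp : p.Prime)
    (h3 : ∃ K : Subgroup G, Nonempty (K ≃* Multiplicative (ZMod p × ZMod p × ZMod p))) :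
    ¬∃ (Q : Type u) (_ : Group Q) (_ : Finite Q) (φ : Q →* G),
      Function.Surjective φ ∧ φ.ker ≤ Subgroup.center Q ∧ IsCyclic φ.ker ∧
      (∀ q : ℕ, q.Prime →
        ¬∃ K : Subgroup Q, Nonempty (K ≃* Multiplicative (ZMod q × ZMod q))) := by
  rintro ⟨Q, _, _, φ, hφ, hcen, hcyc, hQ⟩
  obtain ⟨K, ⟨e⟩⟩ := h3
  have := Fact.mk hp
  apply hQ p hp
  let ι : Multiplicative (ZMod p × ZMod p × ZMod p) →* G := K.subtype.comp e.symm.toMonoidHom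
  have hι : Function.Injective ι := Subtype.val_injective.comp e.symm.injective
  have hιK : ∀ v, ι v ∈ K := fun v => (e.symm v).2
  have hpow : ∀ v : Multiplicative (ZMod p × ZMod p × ZMod p), v ^ p = 1 := by
    intro v
    apply Multiplicative.toAdd.injective
    ext <;> simp
  have hK : ∀ g ∈ K, g ^ p = 1 := by
    intro g hg
    have : (⟨g, hg⟩ : K) ^ p = 1 := e.injective (by rw [map_pow, hpow, map_one])
    exact congrArg Subtype.val this
  obtain ⟨a, ha⟩ := hφ (ι (.ofAdd (1, 0, 0)))
  obtain ⟨b, hb⟩ := hφ (ι (.ofAdd (0, 1, 0)))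
  obtain ⟨c, hc⟩ := hφ (ι (.ofAdd (0, 0, 1)))
  have ha1 : φ a ≠ 1 := by
    rw [ha, Ne, map_eq_one_iff ι hι]
    intro h
    simpa using congrArg (fun v => v.toAdd.1) h
  have hindep : ∀ (y : Q) (v : ZMod p × ZMod p × ZMod p), φ y = ι (.ofAdd v) → v.2 ≠ 0 →
      φ y ∉ Subgroup.zpowers (φ a) := by
    rintro y v hy hv ⟨k, hk⟩
    dsimp only at hk
    rw [hy, ha, ← map_zpow] at hk
    apply hv
    have := congrArg (fun v => v.toAdd.2) (hι hk)
    exact this.symm.trans (by simp)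
  have hmem : ∀ y v, φ y = ι v → φ y ∈ K := fun y v h => h ▸ hιK v
  have hker : ∀ y v, φ y = ι v → y ^ p ∈ φ.ker := fun y v h => by
    rw [MonoidHom.mem_ker, map_pow, hK _ (hmem y v h)]
  have hcomm : ∀ y v, φ y = ι v → ⁅a, y⁆ ∈ φ.ker := fun y v h => by
    rw [MonoidHom.mem_ker, map_commutatorElement, ha, h, commutatorElement_eq_one_iff_mul_comm,
      ← map_mul, ← map_mul, mul_comm]
  rcases commute_or_exists_commute_mul_zpow hp hcen (hker b _ hb) (hker c _ hc) (hcomm b _ hb)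
    (hcomm c _ hc) with h | ⟨k, h⟩
  · exact h.exists_subgroup_mulEquiv_zmod_prod_of_map hp φ hK (hmem a _ ha) (hmem b _ hb) ha1
      (hindep b _ hb (by simp))
  · have hy : φ (c * b ^ k) = ι (.ofAdd ((0, 0, 1) + k • (0, 1, 0))) := by
      rw [map_mul, map_zpow, hb, hc, ← map_zpow, ← map_mul]
      rfl
    exact h.exists_subgroup_mulEquiv_zmod_prod_of_map hp φ hK (hmem a _ ha) (hmem _ _ hy) ha1
      (hindep _ _ hy (by simp))
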